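/- arXiv:2112.00191 — 2 statements merged into one kernel-verified Lean document; each statement's English description precedes it below -/
import Mathlib

section
/- (Lemma 2.1) There exist constants A ≥ 1 and R₀ > 0, depending only on γ, M, M', such that for every ξ ∈ ℝ and every unit vector v ∈ S¹ with |z'(ξ)·v| ≥ |z'(ξ)|/2, there is a function f : [−R₀, R₀] → ℝ with ‖f‖_{C^{1,γ}} ≤ A, f(0) = 0, and f'(0) = (z'(ξ)·v^⊥)/(z'(ξ)·v), such that for each R₁ ∈ [0, R₀] there exist ξ₁, ξ₂ ∈ [R₁/M, 3R₁/M'] with { z(ξ) + h v + f(h) v^⊥ : h ∈ [−R₁, R₁] } = z([ξ−ξ₁, ξ+ξ₂]). In other words, near each of its points the curve z is the graph, over any axis v making angle at most 60° with the tangent, of a function with C^{1,γ} norm at most A. -/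
open Real Set

noncomputable section

abbrev R2 : Type := EuclideanSpace ℝ (Fin 2)

def mk2 (a b : ℝ) : R2 := (EuclideanSpace.equiv (Fin 2) ℝ).symm ![a, b]

/-- Counterclockwise rotation by 90°: `(v₁,v₂)^⊥ = (−v₂,v₁)`. -/
def perp (v : R2) : R2 := mk2 (-(v 1)) (v 0)

/-- The Euclidean dot product on the plane. -/
def dot (x y : R2) : ℝ := x 0 * y 0 + x 1 * y 1

lemma inv_aux (g : ℝ → ℝ) (hg : Continuous g) (c M : ℝ) (hc : 0 < c)
    (h1 : ∀ x, c ≤ g x) (h2 : ∀ x, g x ≤ M) :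
    ∃ P q : ℝ → ℝ, P 0 = 0 ∧ q 0 = 0 ∧ (∀ x, HasDerivAt P (g x) x) ∧
      (∀ h, P (q h) = h) ∧ (∀ x, q (P x) = x) ∧ (∀ h, HasDerivAt q (g (q h))⁻¹ h) ∧
      (∀ a b, a ≤ b → (b - a) / M ≤ q b - q a ∧ q b - q a ≤ (b - a) / c) := by
  have hM : 0 < M := lt_of_lt_of_le hc ((h1 0).trans (h2 0))
  let P : ℝ → ℝ := fun x => ∫ t in (0:ℝ)..x, g t
  have hP : ∀ x, HasDerivAt P (g x) x := fun x => hg.integral_hasStrictDerivAt 0 x |>.hasDerivAt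
  have hP0 : P 0 = 0 := by simp [P]
  have hd : Differentiable ℝ P := fun x => (hP x).differentiableAt
  have hlow : ∀ a b, a ≤ b → c * (b - a) ≤ P b - P a := fun a b hab =>
    mul_sub_le_image_sub_of_le_deriv hd (fun x => by rw [(hP x).deriv]; exact h1 x) hab
  have hup : ∀ a b, a ≤ b → P b - P a ≤ M * (b - a) := fun a b hab =>
    image_sub_le_mul_sub_of_deriv_le hd (fun x => by rw [(hP x).deriv]; exact h2 x) hab
  have hmono : StrictMono P := by
    intro a b hab
    have := hlow a b hab.le
    nlinarith [mul_pos hc (sub_pos.2 hab)]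
  have hsurj : Function.Surjective P := by
    intro y
    have hcont : Continuous P := hd.continuous
    have k1 := hlow 0 (|y| / c) (by positivity)
    have k2 := hlow (-(|y| / c)) 0 (by simp; positivity)
    have e : c * (|y| / c) = |y| := by field_simp
    obtain ⟨x, -, hx⟩ := intermediate_value_Icc (a := -(|y|/c)) (b := |y|/c)
      (by have : 0 ≤ |y| / c := by positivity
          linarith) hcont.continuousOn
      (show y ∈ Icc _ _ from ⟨by nlinarith [neg_abs_le y], by nlinarith [le_abs_self y]⟩)
    exact ⟨x, hx⟩
  let e := StrictMono.orderIsoOfSurjective P hmono hsurj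
  let q : ℝ → ℝ := e.symm
  have hPq : ∀ h, P (q h) = h := fun h => e.apply_symm_apply h
  have hqP : ∀ x, q (P x) = x := fun x => e.symm_apply_apply x
  have hqm : Monotone q := e.symm.monotone
  have hqc : Continuous q := e.symm.continuous
  refine ⟨P, q, hP0, ?_, hP, hPq, hqP, ?_, ?_⟩
  · rw [← hP0, hqP, hP0]
  · intro h
    exact HasDerivAt.of_local_left_inverse hqc.continuousAt (hP (q h))
      (ne_of_gt (hc.trans_le (h1 _))) (Filter.Eventually.of_forall hPq)
  · intro a b hab
    have l := hlow _ _ (hqm hab)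
    have u := hup _ _ (hqm hab)
    rw [hPq, hPq] at l u
    constructor
    · rw [div_le_iff₀ hM]; linarith
    · rw [le_div_iff₀ hc]; linarith

lemma norm_sq2 (v : R2) : ‖v‖ ^ 2 = v 0 ^ 2 + v 1 ^ 2 := by
  rw [EuclideanSpace.norm_sq_eq]; simp [Fin.sum_univ_two]

lemma perp0 (v : R2) : perp v 0 = - v 1 := by simp [perp, mk2]
lemma perp1 (v : R2) : perp v 1 = v 0 := by simp [perp, mk2]

lemma norm_perp (v : R2) (hv : ‖v‖ = 1) : ‖perp v‖ = 1 := by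
  have h := norm_sq2 (perp v)
  have h' := norm_sq2 v
  rw [perp0, perp1] at h
  rw [hv] at h'
  have : ‖perp v‖ ^ 2 = 1 := by linarith
  nlinarith [norm_nonneg (perp v)]

lemma abs_dot_le (x v : R2) (hv : ‖v‖ = 1) : |dot x v| ≤ ‖x‖ := by
  have h := norm_sq2 x
  have h' := norm_sq2 v
  rw [hv] at h'
  apply abs_le_of_sq_le_sq _ (norm_nonneg _)
  rw [h]; unfold dot
  have : x 0 ^ 2 + x 1 ^ 2 = (x 0 ^ 2 + x 1 ^ 2) * (v 0 ^ 2 + v 1 ^ 2) := by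
    rw [← h']; ring
  rw [this]
  nlinarith [sq_nonneg (x 0 * v 1 - x 1 * v 0)]

lemma dot_sub' (x y v : R2) : dot (x - y) v = dot x v - dot y v := by
  simp [dot]; ring

lemma decomp (w v : R2) (hv : ‖v‖ = 1) : dot w v • v + dot w (perp v) • perp v = w := by
  have h' := norm_sq2 v
  rw [hv] at h'
  ext i
  fin_cases i
  · simp [dot, perp0, perp1]
    linear_combination (-w 0) * h'
  · simp [dot, perp0, perp1]
    linear_combination (-w 1) * h'

lemma hasDerivAt_dot (w : ℝ → R2) (w' v : R2) (t : ℝ) (h : HasDerivAt w w' t) :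
    HasDerivAt (fun t => dot (w t) v) (dot w' v) t := by
  have h0 := hasDerivAt_pi.1 ((EuclideanSpace.equiv (Fin 2) ℝ).toContinuousLinearMap.hasFDerivAt.comp_hasDerivAt t h)
  exact ((h0 0).mul_const (v 0)).add ((h0 1).mul_const (v 1))

/-- (Lemma 2.1) Fix `γ ∈ (0,1]` and `M ≥ M' > 0`. There are `A ≥ 1` and `R₀ > 0`, depending
only on `γ, M, M'`, such that for every simple closed `C¹` curve `z` with
`sup|z| + sup|z'| ≤ M`, Hölder seminorm of `z'` at most `M`, and `|z'| ≥ M'`, every `ξ`, and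
every unit vector `v` with `|z'(ξ)·v| ≥ |z'(ξ)|/2`, there is `f : [−R₀,R₀] → ℝ` with
`‖f‖_{C^{1,γ}} ≤ A`, `f(0) = 0`, `f'(0) = (z'(ξ)·v^⊥)/(z'(ξ)·v)`, such that for each
`R₁ ∈ [0,R₀]` there are `ξ₁, ξ₂ ∈ [R₁/M, 3R₁/M']` with
`{z(ξ) + hv + f(h)v^⊥ : h ∈ [−R₁,R₁]} = z([ξ−ξ₁, ξ+ξ₂])`. -/
theorem graph_representation_lemma (γ M M' : ℝ)
    (hγ0 : 0 < γ) (hγ1 : γ ≤ 1) (hM' : 0 < M') (hMM : M' ≤ M) :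
    ∃ A R₀ : ℝ, 1 ≤ A ∧ 0 < R₀ ∧
      ∀ z : ℝ → R2,
        (∀ ξ : ℝ, z (ξ + 2 * π) = z ξ) →
        InjOn z (Ico 0 (2 * π)) →
        ContDiff ℝ 1 z →
        (∀ ξ η : ℝ, ‖z ξ‖ + ‖deriv z η‖ ≤ M) →
        (∀ ξ η : ℝ, ‖deriv z ξ - deriv z η‖ ≤ M * |ξ - η| ^ γ) →
        (∀ ξ : ℝ, M' ≤ ‖deriv z ξ‖) →
        ∀ (ξ : ℝ) (v : R2), ‖v‖ = 1 → ‖deriv z ξ‖ / 2 ≤ |dot (deriv z ξ) v| →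
          ∃ f f' : ℝ → ℝ,
            f 0 = 0 ∧
            f' 0 = dot (deriv z ξ) (perp v) / dot (deriv z ξ) v ∧
            (∀ h ∈ Icc (-R₀) R₀, HasDerivWithinAt f (f' h) (Icc (-R₀) R₀) h) ∧
            (∀ h ∈ Icc (-R₀) R₀, |f h| ≤ A ∧ |f' h| ≤ A) ∧
            (∀ h₁ ∈ Icc (-R₀) R₀, ∀ h₂ ∈ Icc (-R₀) R₀,
              |f' h₁ - f' h₂| ≤ A * |h₁ - h₂| ^ γ) ∧
            (∀ R₁ ∈ Icc 0 R₀, ∃ ξ₁ ∈ Icc (R₁ / M) (3 * R₁ / M'),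
              ∃ ξ₂ ∈ Icc (R₁ / M) (3 * R₁ / M'),
                (fun h => z ξ + h • v + f h • perp v) '' Icc (-R₁) R₁ =
                  z '' Icc (ξ - ξ₁) (ξ + ξ₂)) := by
  have hM : 0 < M := lt_of_lt_of_le hM' hMM
  obtain ⟨δ, hδ, hδM⟩ : ∃ δ : ℝ, 0 < δ ∧ M * δ ^ γ = M' / 6 := by
    refine ⟨(M' / (6 * M)) ^ (γ⁻¹), by positivity, ?_⟩
    rw [← Real.rpow_mul (by positivity), inv_mul_cancel₀ hγ0.ne', Real.rpow_one]
    field_simp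
  have hK : 0 < (3 / M') ^ γ := by positivity
  refine ⟨1 + 2 * M + 3 * M / M' + 18 * M ^ 2 / M' ^ 2 * (3 / M') ^ γ, M' * δ / 3, ?_,
    by positivity, ?_⟩
  · have : 0 ≤ 2 * M + 3 * M / M' + 18 * M ^ 2 / M' ^ 2 * (3 / M') ^ γ := by positivity
    linarith
  intro z _ _ hz hb hH hlow ξ v hv hvd
  have hzb : ∀ x, ‖z x‖ ≤ M := fun x => by linarith [hb x x, norm_nonneg (deriv z x)]
  have hdb : ∀ x, ‖deriv z x‖ ≤ M := fun x => by linarith [hb x x, norm_nonneg (z x)]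
  have hpv := norm_perp v hv
  obtain ⟨s, hss, hsabs, hs⟩ : ∃ s : ℝ, s * s = 1 ∧ |s| = 1 ∧
      s * dot (deriv z ξ) v = |dot (deriv z ξ) v| := by
    rcases le_total 0 (dot (deriv z ξ) v) with h | h
    · exact ⟨1, by norm_num, by norm_num, by rw [abs_of_nonneg h]; ring⟩
    · exact ⟨-1, by norm_num, by norm_num, by rw [abs_of_nonpos h]; ring⟩
  have hzd : ∀ x, HasDerivAt z (deriv z x) x := fun x =>
    (hz.differentiable (by norm_num) x).hasDerivAt
  have hzd' : ∀ t, HasDerivAt (fun t => z (ξ + t) - z ξ) (deriv z (ξ + t)) t := fun t =>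
    ((hzd (ξ + t)).comp_const_add ξ t).sub_const _
  have hdc : Continuous (deriv z) := hz.continuous_deriv le_rfl
  let a : ℝ → ℝ := fun t => dot (deriv z (ξ + t)) v
  let b : ℝ → ℝ := fun t => dot (deriv z (ξ + t)) (perp v)
  have hac : Continuous a := by
    have : Continuous (fun t => deriv z (ξ + t)) := hdc.comp (by fun_prop)
    show Continuous (fun t => (deriv z (ξ + t)) 0 * v 0 + (deriv z (ξ + t)) 1 * v 1)
    fun_prop
  have haM : ∀ t, |a t| ≤ M := fun t => (abs_dot_le _ _ hv).trans (hdb _)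
  have hbM : ∀ t, |b t| ≤ M := fun t => (abs_dot_le _ _ hpv).trans (hdb _)
  have haH : ∀ t u, |a t - a u| ≤ M * |t - u| ^ γ := fun t u => by
    have := hH (ξ + t) (ξ + u)
    rw [add_sub_add_left_eq_sub] at this
    refine le_trans ?_ this
    rw [← dot_sub']
    exact abs_dot_le _ _ hv
  have hbH : ∀ t u, |b t - b u| ≤ M * |t - u| ^ γ := fun t u => by
    have := hH (ξ + t) (ξ + u)
    rw [add_sub_add_left_eq_sub] at this
    refine le_trans ?_ this
    rw [← dot_sub']
    exact abs_dot_le _ _ hpv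
  have hsa : ∀ t, |s * a t| = |a t| := fun t => by rw [abs_mul, hsabs, one_mul]
  have halow : ∀ t, |t| ≤ δ → M' / 3 ≤ s * a t := by
    intro t ht
    have k1 : M' / 2 ≤ s * a 0 := by
      have : s * a 0 = |dot (deriv z ξ) v| := by simp only [a, add_zero]; exact hs
      rw [this]
      linarith [hlow ξ]
    have k2 : |a t - a 0| ≤ M' / 6 := by
      refine (haH t 0).trans ?_
      rw [sub_zero, ← hδM]
      have := Real.rpow_le_rpow (abs_nonneg t) ht hγ0.le
      gcongr
    have k3 : |s * (a t - a 0)| ≤ M' / 6 := by rwa [abs_mul, hsabs, one_mul]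
    have := (abs_le.1 k3).1
    linarith
  obtain ⟨P, q, hP0, hq0, hPd, hPq, hqP, hqd, hqb⟩ := inv_aux (fun t => max (s * a t) (M' / 3))
    (by fun_prop) (M' / 3) M (by positivity) (fun t => le_max_right _ _)
    (fun t => max_le ((le_abs_self _).trans (by rw [hsa]; exact haM t)) (by linarith))
  have hqle : ∀ x y, |q x - q y| ≤ 3 / M' * |x - y| := by
    intro x y
    have e : ∀ w : ℝ, w / (M' / 3) = 3 / M' * w := fun w => by field_simp
    have key : ∀ x y, y ≤ x → |q x - q y| ≤ 3 / M' * |x - y| := by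
      intro x y h
      have := hqb y x h
      have h0 : 0 ≤ (x - y) / M := div_nonneg (by linarith) hM.le
      rw [abs_of_nonneg (by linarith), abs_of_nonneg (by linarith : 0 ≤ x - y), ← e]
      exact this.2
    rcases le_total y x with h | h
    · exact key x y h
    · rw [abs_sub_comm, abs_sub_comm x y]; exact key y x h
  have hqδ : ∀ h, |h| ≤ M' * δ / 3 → |q h| ≤ δ := by
    intro h hh
    have := hqle h 0
    rw [hq0, sub_zero, sub_zero] at this
    refine this.trans ?_
    calc 3 / M' * |h| ≤ 3 / M' * (M' * δ / 3) := by gcongr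
      _ = δ := by field_simp
  have hsh : ∀ h R, h ∈ Icc (-R) R → |s * h| ≤ R := by
    intro h R hh
    rw [abs_mul, hsabs, one_mul]; exact abs_le.2 hh
  have hPeq : ∀ t, |t| ≤ δ → dot (z (ξ + t) - z ξ) v = s * P t := by
    intro t ht
    have hder : ∀ x ∈ Icc (-δ) δ, HasDerivWithinAt
        (fun t => P t - s * dot (z (ξ + t) - z ξ) v) 0 (Icc (-δ) δ) x := by
      intro x hx
      have h1 := (hPd x).sub ((hasDerivAt_dot _ _ v x (hzd' x)).const_mul s)
      have h2 : max (s * a x) (M' / 3) - s * dot (deriv z (ξ + x)) v = 0 := by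
        rw [max_eq_left (halow x (abs_le.2 hx))]
        simp [a]
      rw [← h2]
      exact h1.hasDerivWithinAt
    have := Convex.norm_image_sub_le_of_norm_hasDerivWithin_le (C := 0) hder
      (fun x _ => by simp) (convex_Icc _ _) (show (0:ℝ) ∈ Icc (-δ) δ from ⟨by linarith, hδ.le⟩)
      (show t ∈ Icc (-δ) δ from abs_le.1 ht)
    rw [zero_mul, norm_le_zero_iff] at this
    simp only [hP0, add_zero, sub_self] at this
    have hz0 : dot (0 : R2) v = 0 := by simp [dot]
    rw [hz0] at this
    linear_combination (-s) * this - dot (z (ξ + t) - z ξ) v * hss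
  have hmain : ∀ h ∈ Icc (-(M' * δ / 3)) (M' * δ / 3),
      z ξ + h • v + dot (z (ξ + q (s * h)) - z ξ) (perp v) • perp v = z (ξ + q (s * h)) := by
    intro h hh
    have h1 := hPeq (q (s * h)) (hqδ _ (hsh _ _ hh))
    rw [hPq, ← mul_assoc, hss, one_mul] at h1
    have h2 := decomp (z (ξ + q (s * h)) - z ξ) v hv
    rw [h1] at h2
    rw [add_assoc, h2]; abel
  have halow' : ∀ h ∈ Icc (-(M' * δ / 3)) (M' * δ / 3), M' / 3 ≤ s * a (q (s * h)) :=
    fun h hh => halow _ (hqδ _ (hsh _ _ hh))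
  have haabs : ∀ h ∈ Icc (-(M' * δ / 3)) (M' * δ / 3), M' / 3 ≤ |a (q (s * h))| := by
    intro h hh
    rw [← hsa]
    exact (halow' h hh).trans (le_abs_self _)
  have hane : ∀ h ∈ Icc (-(M' * δ / 3)) (M' * δ / 3), a (q (s * h)) ≠ 0 := by
    intro h hh
    have := haabs h hh
    exact abs_pos.1 (by linarith)
  have hA1 : 0 ≤ 3 * M / M' := by positivity
  have hA2 : 0 ≤ 18 * M ^ 2 / M' ^ 2 * (3 / M') ^ γ := by positivity
  refine ⟨fun h => dot (z (ξ + q (s * h)) - z ξ) (perp v),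
    fun h => b (q (s * h)) / a (q (s * h)), ?_, ?_, ?_, ?_, ?_, ?_⟩
  · simp [hq0, dot]
  · simp [hq0, a, b]
  · intro h hh
    have h1 : HasDerivAt (fun h => q (s * h)) ((s * a (q (s * h)))⁻¹ * s) h := by
      have := (hqd (s * h)).comp h ((hasDerivAt_id h).const_mul s)
      simp only [max_eq_left (halow' h hh), mul_one] at this
      exact this
    have h2 := (hasDerivAt_dot _ _ (perp v) _ (hzd' (q (s * h)))).comp h h1
    have h3 : dot (deriv z (ξ + q (s * h))) (perp v) * ((s * a (q (s * h)))⁻¹ * s)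
        = b (q (s * h)) / a (q (s * h)) := by
      have := hane h hh
      have hs0 : s ≠ 0 := by rintro rfl; simp at hss
      simp only [b]
      field_simp
    rw [h3] at h2
    exact h2.hasDerivWithinAt
  · intro h hh
    constructor
    · refine (abs_dot_le _ _ hpv).trans ?_
      have := norm_sub_le (z (ξ + q (s * h))) (z ξ)
      linarith [hzb (ξ + q (s * h)), hzb ξ]
    · have : |b (q (s * h)) / a (q (s * h))| ≤ M / (M' / 3) := by
        rw [abs_div]
        exact div_le_div₀ hM.le (hbM _) (by positivity) (haabs h hh)
      have e : M / (M' / 3) = 3 * M / M' := by field_simp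
      linarith
  · intro h₁ hh₁ h₂ hh₂
    have n1 := hane h₁ hh₁
    have n2 := hane h₂ hh₂
    have l1 := haabs h₁ hh₁
    have l2 := haabs h₂ hh₂
    have hq := hqle (s * h₁) (s * h₂)
    rw [← mul_sub, abs_mul s, hsabs, one_mul] at hq
    have hqγ : |q (s * h₁) - q (s * h₂)| ^ γ ≤ (3 / M') ^ γ * |h₁ - h₂| ^ γ := by
      rw [← Real.mul_rpow (by positivity) (abs_nonneg _)]
      exact Real.rpow_le_rpow (abs_nonneg _) hq hγ0.le
    have ha := haH (q (s * h₁)) (q (s * h₂))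
    have hb' := hbH (q (s * h₁)) (q (s * h₂))
    have hb2 := hbM (q (s * h₂))
    have ha2 := haM (q (s * h₂))
    simp only
    generalize q (s * h₁) = t at *
    generalize q (s * h₂) = u at *
    set D := |t - u| ^ γ with hD
    have hD0 : 0 ≤ D := by positivity
    have e : b t / a t - b u / a u = ((b t - b u) * a u - b u * (a t - a u)) / (a t * a u) := by
      field_simp; ring
    have num : |(b t - b u) * a u - b u * (a t - a u)| ≤ 2 * M ^ 2 * D := by
      refine (abs_sub _ _).trans ?_
      rw [abs_mul, abs_mul]
      have i1 : |b t - b u| * |a u| ≤ (M * D) * M := by gcongr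
      have i2 : |b u| * |a t - a u| ≤ M * (M * D) := by gcongr
      nlinarith
    have den : M' / 3 * (M' / 3) ≤ |a t * a u| := by
      rw [abs_mul]; gcongr
    rw [e, abs_div]
    calc _ ≤ (2 * M ^ 2 * D) / (M' / 3 * (M' / 3)) :=
          div_le_div₀ (by positivity) num (by positivity) den
      _ = 18 * M ^ 2 / M' ^ 2 * D := by field_simp; ring
      _ ≤ 18 * M ^ 2 / M' ^ 2 * ((3 / M') ^ γ * |h₁ - h₂| ^ γ) := by gcongr
      _ = (18 * M ^ 2 / M' ^ 2 * (3 / M') ^ γ) * |h₁ - h₂| ^ γ := by ring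
      _ ≤ _ := by
        gcongr
        linarith
  · intro R₁ hR
    have e : ∀ w : ℝ, w / (M' / 3) = 3 * w / M' := fun w => by field_simp
    have k1 := hqb (-R₁) 0 (by linarith [hR.1])
    have k2 := hqb 0 R₁ hR.1
    rw [hq0, e] at k1 k2
    simp only [sub_zero, zero_sub, neg_neg] at k1 k2
    have hqm : Monotone q := by
      intro x y h
      have := (hqb x y h).1
      have h0 : 0 ≤ (y - x) / M := div_nonneg (by linarith) hM.le
      linarith
    have hPm : Monotone P := by
      intro x y h
      by_contra! hlt
      have := hqm hlt.le
      rw [hqP, hqP] at this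
      have : x = y := le_antisymm h this
      subst this
      exact lt_irrefl _ hlt
    refine ⟨-q (-R₁), k1, q R₁, k2, ?_⟩
    ext w
    constructor
    · rintro ⟨h, hh, rfl⟩
      have hh' : h ∈ Icc (-(M' * δ / 3)) (M' * δ / 3) :=
        ⟨by linarith [hh.1, hR.2], by linarith [hh.2, hR.2]⟩
      have h3 := abs_le.1 (hsh h R₁ hh)
      refine ⟨ξ + q (s * h), ⟨?_, ?_⟩, (hmain h hh').symm⟩
      · linarith [hqm h3.1]
      · linarith [hqm h3.2]
    · rintro ⟨x, hx, rfl⟩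
      have l1 : q (-R₁) ≤ x - ξ := by linarith [hx.1]
      have l2 : x - ξ ≤ q R₁ := by linarith [hx.2]
      have m1 := hPm l1
      have m2 := hPm l2
      rw [hPq] at m1 m2
      have hh : s * P (x - ξ) ∈ Icc (-R₁) R₁ := abs_le.1 (hsh _ _ ⟨m1, m2⟩)
      have hh' : s * P (x - ξ) ∈ Icc (-(M' * δ / 3)) (M' * δ / 3) :=
        ⟨by linarith [hh.1, hR.2], by linarith [hh.2, hR.2]⟩
      refine ⟨s * P (x - ξ), hh, ?_⟩
      have := hmain _ hh'
      simp only
      rw [this, ← mul_assoc, hss, one_mul, hqP, add_sub_cancel]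

end
end

section
/- (Lemma 2.3) Suppose in addition that z(η₀) = (0,0) and z'(η₀) is parallel to (1,0) for some η₀ ∈ ℝ. Then there exist constants A, B, R > 0, depending only on γ, M, M', with B(3R)^{γ/(1+γ)} ≤ 1/2 and M(4R)^γ ≤ (M')^{1+γ}, such that for any ξ ∈ ℝ with z(ξ) ∈ [−R,R] × [−2R,2R] there is a function f : [−R,R] → ℝ with ‖f‖_{C^{1,γ}} ≤ A, f(z₁(ξ)) = z₂(ξ), and |f'(z₁(ξ))| ≤ B |z(ξ)|^{γ/(1+γ)}, whose graph {(h, f(h)) : h ∈ [−R,R]} equals z(I) for some closed interval I containing ξ (a segment of the curve z around z(ξ)). Consequently |f(h) − z₂(ξ) − f'(z₁(ξ))(h − z₁(ξ))| ≤ A |h − z₁(ξ)|^{1+γ} for all h ∈ [−R,R]; and if |f(h')| > 2R for some h' ∈ [−R,R], then |f(h)| > R for all h ∈ [−R,R]. -/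
open Real Set

noncomputable section

lemma aux_taylor (γ K : ℝ) (hγ0 : 0 < γ) (hK : 0 ≤ K) (g g' : ℝ → ℝ) (a b : ℝ)
    (hg : ∀ t ∈ uIcc a b, HasDerivAt g (g' t) t)
    (hh : ∀ t ∈ uIcc a b, |g' t - g' a| ≤ K * |t - a| ^ γ) :
    |g b - g a - g' a * (b - a)| ≤ K * |b - a| ^ (1 + γ) := by
  have h := (convex_uIcc a b).norm_image_sub_le_of_norm_hasDerivWithin_le
    (f := fun t => g t - g' a * t) (f' := fun t => g' t - g' a) (C := K * |b - a| ^ γ)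
    (x := a) (y := b) (fun t ht => by
      have h0 := ((hg t ht).sub ((hasDerivAt_id t).const_mul (g' a))).hasDerivWithinAt
        (s := uIcc a b)
      rw [mul_one] at h0
      exact h0)
    (fun t ht => by
      refine (hh t ht).trans ?_
      have : |t - a| ≤ |b - a| := abs_sub_left_of_mem_uIcc ht
      gcongr) left_mem_uIcc right_mem_uIcc
  rw [Real.norm_eq_abs, Real.norm_eq_abs, mul_assoc] at h
  have e : |b - a| ^ (1 + γ) = |b - a| ^ γ * |b - a| := by
    rw [Real.rpow_add_of_nonneg (abs_nonneg _) zero_le_one hγ0.le, Real.rpow_one, mul_comm]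
  rw [e]
  convert h using 2
  ring

lemma aux_inv_pos (γ M M' δ R : ℝ) (hγ0 : 0 < γ) (hM' : 0 < M') (hM : 0 < M)
    (hR : 0 < R) (hδM : M * δ ^ γ ≤ M' / 4) (hRδ : 16 * R ≤ M' * δ)
    (x x' : ℝ → ℝ) (hx : ∀ t, HasDerivAt x (x' t) t)
    (hh : ∀ s t, |x' s - x' t| ≤ M * |s - t| ^ γ)
    (ξ : ℝ) (hξ : |x ξ| ≤ R) (hξ' : M' / 2 ≤ x' ξ) :
    ∃ t : ℝ → ℝ, (∀ h ∈ Icc (-R) R, x (t h) = h) ∧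
      (∀ h₁ ∈ Icc (-R) R, ∀ h₂ ∈ Icc (-R) R, |t h₁ - t h₂| ≤ 4 / M' * |h₁ - h₂|) ∧
      t (x ξ) = ξ ∧ (∀ h ∈ Icc (-R) R, HasDerivAt t (x' (t h))⁻¹ h) ∧
      (∀ h ∈ Icc (-R) R, M' / 4 ≤ |x' (t h)|) ∧
      ∃ ξ₁ ξ₂, ξ₁ ≤ ξ ∧ ξ ≤ ξ₂ ∧ t '' Icc (-R) R = Icc ξ₁ ξ₂ := by
  have hδ : 0 < δ := by
    by_contra hc
    have : M' * δ ≤ 0 := mul_nonpos_of_nonneg_of_nonpos hM'.le (not_lt.1 hc)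
    linarith
  set I := Icc (ξ - δ) (ξ + δ) with hI
  have hd : ∀ t ∈ I, M' / 4 ≤ x' t := by
    intro t ht
    have h1 := hh ξ t
    have h2 : |ξ - t| ≤ δ := by rw [abs_le]; constructor <;> linarith [ht.1, ht.2]
    have h3 : |ξ - t| ^ γ ≤ δ ^ γ := by gcongr
    have h4 := (abs_le.1 (h1.trans ((mul_le_mul_of_nonneg_left h3 hM.le).trans hδM))).2
    linarith
  have hxc : Continuous x := continuous_iff_continuousAt.2 fun t => (hx t).continuousAt
  have hmono : ∀ a ∈ I, ∀ b ∈ I, a ≤ b → M' / 4 * (b - a) ≤ x b - x a := by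
    intro a ha b hb hab
    exact (convex_Icc (ξ - δ) (ξ + δ)).mul_sub_le_image_sub_of_le_deriv hxc.continuousOn
      (fun t _ => (hx t).differentiableAt.differentiableWithinAt)
      (fun t ht => by rw [(hx t).deriv]; exact hd t (interior_subset ht)) a ha b hb hab
  have hξI : ξ ∈ I := ⟨by linarith, by linarith⟩
  have hlI : ξ - δ ∈ I := ⟨by linarith, by linarith⟩
  have hrI : ξ + δ ∈ I := ⟨by linarith, by linarith⟩
  obtain ⟨hξa, hξb⟩ := abs_le.1 hξ
  have hr : 3 * R ≤ x (ξ + δ) := by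
    have := hmono ξ hξI _ hrI (by linarith); linarith
  have hl : x (ξ - δ) ≤ -(3 * R) := by
    have := hmono _ hlI ξ hξI (by linarith); linarith
  have hex : ∀ h, ∃ t, h ∈ Icc (-(3 * R)) (3 * R) → t ∈ I ∧ x t = h := by
    intro h
    by_cases hm : h ∈ Icc (-(3 * R)) (3 * R)
    · obtain ⟨t, ht, hth⟩ := intermediate_value_Icc (show ξ - δ ≤ ξ + δ by linarith)
        hxc.continuousOn (show h ∈ Icc _ _ from ⟨by linarith [hm.1], by linarith [hm.2]⟩)
      exact ⟨t, fun _ => ⟨ht, hth⟩⟩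
    · exact ⟨0, fun h => absurd h hm⟩
  choose t ht using hex
  have hsub : ∀ h ∈ Icc (-R) R, h ∈ Icc (-(3 * R)) (3 * R) := fun h hm =>
    ⟨by linarith [hm.1], by linarith [hm.2]⟩
  have hlip0 : ∀ a ∈ I, ∀ b ∈ I, |a - b| ≤ 4 / M' * |x a - x b| := by
    have key : ∀ a ∈ I, ∀ b ∈ I, a ≤ b → |a - b| ≤ 4 / M' * |x a - x b| := by
      intro a ha b hb hab
      have h1 := hmono a ha b hb hab
      rw [abs_sub_comm, abs_of_nonneg (by linarith : 0 ≤ b - a), abs_sub_comm (x a)]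
      have h2 := h1.trans (le_abs_self _)
      rw [div_mul_eq_mul_div, le_div_iff₀ hM']
      linarith
    intro a ha b hb
    rcases le_total a b with h | h
    · exact key a ha b hb h
    · rw [abs_sub_comm, abs_sub_comm (x a)]; exact key b hb a ha h
  have hlip : ∀ h₁ ∈ Icc (-(3 * R)) (3 * R), ∀ h₂ ∈ Icc (-(3 * R)) (3 * R),
      |t h₁ - t h₂| ≤ 4 / M' * |h₁ - h₂| := by
    intro h₁ hm₁ h₂ hm₂
    have := hlip0 _ (ht h₁ hm₁).1 _ (ht h₂ hm₂).1
    rwa [(ht h₁ hm₁).2, (ht h₂ hm₂).2] at this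
  have hinv : ∀ a ∈ I, x a ∈ Icc (-(3 * R)) (3 * R) → t (x a) = a := by
    intro a ha hxa
    have := hlip0 _ (ht _ hxa).1 _ ha
    rw [(ht _ hxa).2] at this
    simp only [sub_self, abs_zero, mul_zero] at this
    exact sub_eq_zero.1 (abs_eq_zero.1 (le_antisymm this (abs_nonneg _)))
  have hxm : ∀ a ∈ I, ∀ b ∈ I, x a ≤ x b → a ≤ b := by
    intro a ha b hb hab
    by_contra hc
    have := hmono b hb a ha (by linarith)
    nlinarith [mul_pos hM' (sub_pos.2 (not_le.1 hc))]
  have hRm : R ∈ Icc (-R) R := ⟨by linarith, le_rfl⟩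
  have hRm' : -R ∈ Icc (-R) R := ⟨le_rfl, by linarith⟩
  have hTR := ht R (hsub R hRm)
  have hTR' := ht (-R) (hsub (-R) hRm')
  refine ⟨t, fun h hm => (ht h (hsub h hm)).2, fun h₁ hm₁ h₂ hm₂ =>
    hlip _ (hsub _ hm₁) _ (hsub _ hm₂), hinv ξ hξI (hsub _ ⟨hξa, hξb⟩), ?_, ?_,
    t (-R), t R, hxm _ hTR'.1 _ hξI (by rw [hTR'.2]; exact hξa),
      hxm _ hξI _ hTR.1 (by rw [hTR.2]; exact hξb), ?_⟩
  · intro h hm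
    have hnh : Icc (-(3 * R)) (3 * R) ∈ nhds h :=
      Icc_mem_nhds (by linarith [hm.1]) (by linarith [hm.2])
    have hcont : ContinuousAt t h := by
      have hL : LipschitzOnWith (Real.toNNReal (4 / M')) t (Icc (-(3 * R)) (3 * R)) := by
        apply LipschitzOnWith.of_dist_le_mul
        intro a ha b hb
        rw [Real.coe_toNNReal _ (by positivity), Real.dist_eq, Real.dist_eq]
        exact hlip a ha b hb
      exact hL.continuousOn.continuousAt hnh
    refine HasDerivAt.of_local_left_inverse hcont (hx (t h)) ?_ ?_
    · have := hd _ (ht h (hsub h hm)).1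
      linarith
    · filter_upwards [hnh] with a ha using (ht a ha).2
  · intro h hm
    exact (hd _ (ht h (hsub h hm)).1).trans (le_abs_self _)
  · apply Subset.antisymm
    · rintro _ ⟨h, hm, rfl⟩
      have hT := ht h (hsub h hm)
      exact ⟨hxm _ hTR'.1 _ hT.1 (by rw [hTR'.2, hT.2]; exact hm.1),
        hxm _ hT.1 _ hTR.1 (by rw [hTR.2, hT.2]; exact hm.2)⟩
    · intro a ha
      have haI : a ∈ I := ⟨hTR'.1.1.trans ha.1, ha.2.trans hTR.1.2⟩
      have h1 := hmono _ hTR'.1 _ haI ha.1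
      have h2 := hmono _ haI _ hTR.1 ha.2
      rw [hTR'.2] at h1
      rw [hTR.2] at h2
      have h3 : 0 ≤ M' / 4 * (a - t (-R)) := mul_nonneg (by linarith) (by linarith [ha.1])
      have h4 : 0 ≤ M' / 4 * (t R - a) := mul_nonneg (by linarith) (by linarith [ha.2])
      have hxa : x a ∈ Icc (-R) R := ⟨by linarith, by linarith⟩
      exact ⟨x a, hxa, hinv a haI (hsub _ hxa)⟩

lemma aux_inv (γ M M' δ R : ℝ) (hγ0 : 0 < γ) (hM' : 0 < M') (hM : 0 < M)
    (hR : 0 < R) (hδM : M * δ ^ γ ≤ M' / 4) (hRδ : 16 * R ≤ M' * δ)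
    (x x' : ℝ → ℝ) (hx : ∀ t, HasDerivAt x (x' t) t)
    (hh : ∀ s t, |x' s - x' t| ≤ M * |s - t| ^ γ)
    (ξ : ℝ) (hξ : |x ξ| ≤ R) (hξ' : M' / 2 ≤ |x' ξ|) :
    ∃ t : ℝ → ℝ, (∀ h ∈ Icc (-R) R, x (t h) = h) ∧
      (∀ h₁ ∈ Icc (-R) R, ∀ h₂ ∈ Icc (-R) R, |t h₁ - t h₂| ≤ 4 / M' * |h₁ - h₂|) ∧
      t (x ξ) = ξ ∧ (∀ h ∈ Icc (-R) R, HasDerivAt t (x' (t h))⁻¹ h) ∧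
      (∀ h ∈ Icc (-R) R, M' / 4 ≤ |x' (t h)|) ∧
      ∃ ξ₁ ξ₂, ξ₁ ≤ ξ ∧ ξ ≤ ξ₂ ∧ t '' Icc (-R) R = Icc ξ₁ ξ₂ := by
  rcases le_total 0 (x' ξ) with hs | hs
  · rw [abs_of_nonneg hs] at hξ'
    exact aux_inv_pos γ M M' δ R hγ0 hM' hM hR hδM hRδ x x' hx hh ξ hξ hξ'
  · rw [abs_of_nonpos hs] at hξ'
    obtain ⟨t, h1, h2, h3, h4, h5, ξ₁, ξ₂, h6, h7, h8⟩ :=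
      aux_inv_pos γ M M' δ R hγ0 hM' hM hR hδM hRδ (fun t => - x t) (fun t => - x' t)
        (fun t => (hx t).neg)
        (fun s t => by rw [← abs_neg]; convert hh s t using 2; ring) ξ
        (by simpa using hξ) hξ'
    have hn : ∀ h ∈ Icc (-R) R, -h ∈ Icc (-R) R := fun h hm =>
      ⟨by linarith [hm.2], by linarith [hm.1]⟩
    refine ⟨fun h => t (-h), fun h hm => ?_, fun a ha b hb => ?_, h3, fun h hm => ?_,
      fun h hm => ?_, ξ₁, ξ₂, h6, h7, ?_⟩
    · have := h1 _ (hn h hm); simp only at this ⊢; linarith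
    · refine (h2 _ (hn a ha) _ (hn b hb)).trans (le_of_eq ?_)
      rw [← abs_neg]; congr 2; ring
    · have := (h4 _ (hn h hm)).comp h (hasDerivAt_neg h)
      have e : (-x' (t (-h)))⁻¹ * -1 = (x' (t (-h)))⁻¹ := by rw [inv_neg]; ring
      rw [e] at this
      exact this
    · simpa using h5 _ (hn h hm)
    · rw [← h8]
      ext a
      constructor
      · rintro ⟨h, hm, rfl⟩; exact ⟨-h, hn h hm, rfl⟩
      · rintro ⟨h, hm, rfl⟩; exact ⟨-h, hn h hm, by simp⟩

lemma aux_holder (γ M M' R : ℝ) (hγ0 : 0 < γ) (hM' : 0 < M') (hM : 0 < M)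
    (x' y' t : ℝ → ℝ)
    (hhx : ∀ s t, |x' s - x' t| ≤ M * |s - t| ^ γ)
    (hhy : ∀ s t, |y' s - y' t| ≤ M * |s - t| ^ γ)
    (hx'M : ∀ t, |x' t| ≤ M) (hy'M : ∀ t, |y' t| ≤ M)
    (ht2 : ∀ h₁ ∈ Icc (-R) R, ∀ h₂ ∈ Icc (-R) R, |t h₁ - t h₂| ≤ 4 / M' * |h₁ - h₂|)
    (ht5 : ∀ h ∈ Icc (-R) R, M' / 4 ≤ |x' (t h)|) :
    ∀ h₁ ∈ Icc (-R) R, ∀ h₂ ∈ Icc (-R) R,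
      |y' (t h₁) * (x' (t h₁))⁻¹ - y' (t h₂) * (x' (t h₂))⁻¹| ≤
        (2 * M * (M * (4 / M') ^ γ) / (M' / 4) ^ 2) * |h₁ - h₂| ^ γ := by
  intro a ha b hb
  have hK : 0 < 4 / M' := by positivity
  set D := M * ((4 / M') ^ γ * |a - b| ^ γ) with hD
  have hDt : M * |t a - t b| ^ γ ≤ D := by
    have := ht2 a ha b hb
    rw [hD, ← Real.mul_rpow hK.le (abs_nonneg _)]
    gcongr
  have h1 := (hhx (t a) (t b)).trans hDt
  have h2 := (hhy (t a) (t b)).trans hDt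
  have hD0 : 0 ≤ D := (abs_nonneg _).trans h1
  have ha5 := ht5 a ha
  have hb5 := ht5 b hb
  have hxa := hx'M (t a)
  have hxb := hx'M (t b)
  have hyb := hy'M (t b)
  generalize x' (t a) = p at *
  generalize x' (t b) = q at *
  generalize y' (t a) = u at *
  generalize y' (t b) = v at *
  have hp : 0 < |p| := by linarith
  have hq : 0 < |q| := by linarith
  have hp0 : p ≠ 0 := abs_pos.1 hp
  have hq0 : q ≠ 0 := abs_pos.1 hq
  have e : u * p⁻¹ - v * q⁻¹ = ((u - v) * q - v * (p - q)) / (p * q) := by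
    field_simp; ring
  have hnum : |(u - v) * q - v * (p - q)| ≤ 2 * M * D := by
    refine (abs_sub _ _).trans ?_
    rw [abs_mul, abs_mul]
    have i1 : |u - v| * |q| ≤ D * M := mul_le_mul h2 hxb (abs_nonneg _) hD0
    have i2 : |v| * |p - q| ≤ M * D := mul_le_mul hyb h1 (abs_nonneg _) hM.le
    linarith
  have hden : (M' / 4) ^ 2 ≤ |p * q| := by
    rw [abs_mul, sq]
    exact mul_le_mul ha5 hb5 (by positivity) hp.le
  rw [e, abs_div]
  calc _ ≤ 2 * M * D / (M' / 4) ^ 2 := by gcongr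
    _ = _ := by rw [hD]; ring

lemma aux_slope (γ M M' δ R₀ A s : ℝ) (hγ0 : 0 < γ) (hγ1 : γ ≤ 1) (hM' : 0 < M') (hM : 0 < M)
    (hR : 0 < R₀) (hδM : M * δ ^ γ ≤ M' / 4) (hRδ : 16 * R₀ ≤ M' * δ)
    (hA : 2 * M * (M * (4 / M') ^ γ) / (M' / 4) ^ 2 ≤ A)
    (x x' y y' : ℝ → ℝ) (hx : ∀ t, HasDerivAt x (x' t) t) (hy : ∀ t, HasDerivAt y (y' t) t)
    (hhx : ∀ s t, |x' s - x' t| ≤ M * |s - t| ^ γ)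
    (hhy : ∀ s t, |y' s - y' t| ≤ M * |s - t| ^ γ)
    (hx'M : ∀ t, |x' t| ≤ M) (hy'M : ∀ t, |y' t| ≤ M)
    (hper : ∀ t u, x t = x u → y t = y u → ∀ d, y' (t + d) = y' (u + d))
    (η₀ : ℝ) (hx0 : x η₀ = 0) (hy0 : y η₀ = 0) (hy'0 : y' η₀ = 0) (hx'0 : M' ≤ |x' η₀|)
    (ξ : ℝ) (hs0 : 0 < s) (hs1 : s ≤ 1) (hsR : (1 + M) * s ≤ R₀)
    (hxξ : |x ξ| ≤ s ^ (1 + γ)) (hyξ : |y ξ| ≤ s ^ (1 + γ)) :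
    |y' ξ| ≤ (1 + M + A * (1 + M) ^ 2 + M * (1 + 4 / M' * (1 + M)) ^ γ) * s ^ γ := by
  obtain ⟨t, ht1, ht2, ht3, ht4, ht5, -⟩ := aux_inv γ M M' δ R₀ hγ0 hM' hM hR hδM hRδ x x' hx hhx η₀
    (by rw [hx0]; simpa using hR.le) (by linarith)
  rw [hx0] at ht3
  have hA0 : 0 ≤ A := le_trans (by positivity) hA
  have hHol := aux_holder γ M M' R₀ hγ0 hM' hM x' y' t hhx hhy hx'M hy'M ht2 ht5
  have h0m : (0:ℝ) ∈ Icc (-R₀) R₀ := ⟨by linarith, hR.le⟩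
  have hs1γ : s ^ (1 + γ) = s * s ^ γ := by
    rw [Real.rpow_add hs0, Real.rpow_one]
  have hsγ0 : 0 < s ^ γ := Real.rpow_pos_of_pos hs0 γ
  have hsγ1 : s ^ γ ≤ 1 := Real.rpow_le_one hs0.le hs1 hγ0.le
  have hss : s ^ (1 + γ) ≤ s := by rw [hs1γ]; nlinarith
  have hder : ∀ h ∈ Icc (-R₀) R₀, HasDerivAt (fun h => y (t h)) (y' (t h) * (x' (t h))⁻¹) h :=
    fun h hm => (hy (t h)).comp h (ht4 h hm)
  -- the graph is flat
  have hflat : ∀ h, |h| ≤ (1 + M) * s → |y (t h)| ≤ A * (1 + M) ^ 2 * s ^ (1 + γ) := by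
    intro h hh
    have hsub : uIcc 0 h ⊆ Icc (-R₀) R₀ := by
      rw [abs_le] at hh
      exact (convex_Icc (-R₀) R₀).ordConnected.uIcc_subset h0m ⟨by linarith, by linarith⟩
    have h1 := aux_taylor γ A hγ0 hA0 (fun h => y (t h)) (fun h => y' (t h) * (x' (t h))⁻¹) 0 h
      (fun a ha => hder a (hsub ha)) (fun a ha => (hHol a (hsub ha) 0 h0m).trans (by gcongr))
    simp only [ht3, hy0, hy'0, zero_mul, sub_zero] at h1
    refine h1.trans ?_
    rw [mul_assoc]
    gcongr
    calc |h| ^ (1 + γ) ≤ ((1 + M) * s) ^ (1 + γ) := by gcongr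
      _ = (1 + M) ^ (1 + γ) * s ^ (1 + γ) := Real.mul_rpow (by linarith) hs0.le
      _ ≤ (1 + M) ^ 2 * s ^ (1 + γ) := by
        gcongr
        rw [← Real.rpow_natCast]
        apply Real.rpow_le_rpow_of_exponent_le (by linarith)
        push_cast; linarith
  have hxτ : ∀ a ∈ Icc (ξ - s) (ξ + s), |x a| ≤ (1 + M) * s := by
    intro a ha
    have h1 := (convex_univ (𝕜 := ℝ) (E := ℝ)).norm_image_sub_le_of_norm_hasDerivWithin_le
      (f := x) (f' := x') (C := M) (x := ξ) (y := a)
      (fun t _ => (hx t).hasDerivWithinAt) (fun t _ => hx'M t) (mem_univ _) (mem_univ _)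
    rw [Real.norm_eq_abs, Real.norm_eq_abs] at h1
    have h2 : |a - ξ| ≤ s := by rw [abs_le]; constructor <;> linarith [ha.1, ha.2]
    have h3 : M * |a - ξ| ≤ M * s := by gcongr
    have h4 := abs_sub_abs_le_abs_sub (x a) (x ξ)
    linarith
  have hxR : ∀ a ∈ Icc (ξ - s) (ξ + s), x a ∈ Icc (-R₀) R₀ := fun a ha =>
    abs_le.1 ((hxτ a ha).trans hsR)
  by_contra hcon
  push Not at hcon
  set P := M * (1 + 4 / M' * (1 + M)) ^ γ with hP
  have hP0 : 0 ≤ P := by positivity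
  have hcross : ∃ a ∈ Icc (ξ - s) (ξ + s), y a - y (t (x a)) = 0 := by
    have hxc : Continuous x := continuous_iff_continuousAt.2 fun t => (hx t).continuousAt
    have hyc : Continuous y := continuous_iff_continuousAt.2 fun t => (hy t).continuousAt
    have hgc : ContinuousOn (fun a => y a - y (t (x a))) (Icc (ξ - s) (ξ + s)) := by
      apply hyc.continuousOn.sub
      have : ContinuousOn (fun h => y (t h)) (Icc (-R₀) R₀) := fun h hm =>
        (hder h hm).continuousAt.continuousWithinAt
      exact this.comp hxc.continuousOn hxR
    have hm1 : ξ - s ∈ Icc (ξ - s) (ξ + s) := ⟨by linarith, by linarith⟩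
    have hm2 : ξ + s ∈ Icc (ξ - s) (ξ + s) := ⟨by linarith, by linarith⟩
    have f1 := abs_le.1 (hflat _ (hxτ _ hm1))
    have f2 := abs_le.1 (hflat _ (hxτ _ hm2))
    have g1 := abs_le.1 (aux_taylor γ M hγ0 hM.le y y' ξ (ξ - s) (fun a _ => hy a) (fun a _ => hhy a ξ))
    have g2 := abs_le.1 (aux_taylor γ M hγ0 hM.le y y' ξ (ξ + s) (fun a _ => hy a) (fun a _ => hhy a ξ))
    have e1 : ξ - s - ξ = -s := by ring
    have e2 : ξ + s - ξ = s := by ring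
    rw [e1, abs_neg, abs_of_pos hs0] at g1
    rw [e2, abs_of_pos hs0] at g2
    have y0 := abs_le.1 hyξ
    have hc2 : (1 + M + A * (1 + M) ^ 2) * s ^ (1 + γ) ≤ |y' ξ| * s := by
      rw [hs1γ]
      have : (1 + M + A * (1 + M) ^ 2) * s ^ γ ≤ |y' ξ| := by
        have := mul_nonneg hP0 hsγ0.le
        linarith
      have := mul_le_mul_of_nonneg_right this hs0.le
      linarith
    rcases le_total 0 (y' ξ) with hsg | hsg
    · rw [abs_of_nonneg hsg] at hc2
      obtain ⟨a, ha, h⟩ := intermediate_value_Icc (show ξ - s ≤ ξ + s by linarith) hgc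
        (show (0:ℝ) ∈ Icc _ _ from ⟨by linarith, by linarith⟩)
      exact ⟨a, ha, h⟩
    · rw [abs_of_nonpos hsg] at hc2
      obtain ⟨a, ha, h⟩ := intermediate_value_Icc' (show ξ - s ≤ ξ + s by linarith) hgc
        (show (0:ℝ) ∈ Icc _ _ from ⟨by linarith, by linarith⟩)
      exact ⟨a, ha, h⟩
  obtain ⟨a, ha, hya⟩ := hcross
  have hp := hper a (t (x a)) (ht1 _ (hxR a ha)).symm (by linarith) (η₀ - t (x a))
  rw [add_sub_cancel, hy'0] at hp
  have h1 := hhy ξ (a + (η₀ - t (x a)))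
  rw [hp, sub_zero] at h1
  have h2 : |ξ - (a + (η₀ - t (x a)))| ≤ (1 + 4 / M' * (1 + M)) * s := by
    have i1 := ht2 _ (hxR a ha) 0 h0m
    rw [ht3, sub_zero] at i1
    have i2 : 4 / M' * |x a| ≤ 4 / M' * ((1 + M) * s) := by
      have := hxτ a ha
      gcongr
    have i3 := abs_le.1 (i1.trans i2)
    rw [abs_le]
    constructor <;> linarith [ha.1, ha.2]
  have h3 : M * |ξ - (a + (η₀ - t (x a)))| ^ γ ≤ P * s ^ γ := by
    rw [hP, mul_assoc, ← Real.mul_rpow (by positivity) hs0.le]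
    gcongr
  have h4 : 0 ≤ (1 + M + A * (1 + M) ^ 2) * s ^ γ := by positivity
  linarith

lemma aux_small (c p ε : ℝ) (hp : 0 < p) (hε : 0 < ε) (k : ℝ) :
    ∀ᶠ R in nhdsWithin (0:ℝ) (Ioi 0), c * (k * R) ^ p ≤ ε := by
  have h : Filter.Tendsto (fun R : ℝ => c * (k * R) ^ p) (nhds 0) (nhds (c * (k * 0) ^ p)) := by
    have hc : Continuous (fun R : ℝ => c * (k * R) ^ p) := by
      refine continuous_const.mul ?_
      exact (continuous_const.mul continuous_id).rpow_const (fun _ => Or.inr hp.le)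
    exact hc.tendsto 0
  rw [mul_zero, Real.zero_rpow hp.ne', mul_zero] at h
  exact nhdsWithin_le_nhds ((h.eventually (gt_mem_nhds hε)).mono fun _ h => h.le)

lemma aux_inj (z : ℝ → R2) (hp : ∀ ξ : ℝ, z (ξ + 2 * π) = z ξ)
    (hi : InjOn z (Ico 0 (2 * π))) (t u : ℝ) (h : z t = z u) (d : ℝ) :
    deriv z (t + d) = deriv z (u + d) := by
  have hpi : (0:ℝ) < 2 * π := by positivity
  have hP : Function.Periodic z (2 * π) := hp
  obtain ⟨a, ha, hta⟩ : ∃ a ∈ Ico 0 (2 * π), ∃ k : ℤ, t = a + k * (2 * π) :=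
    ⟨toIcoMod hpi 0 t, by simpa using toIcoMod_mem_Ico hpi 0 t, toIcoDiv hpi 0 t, by
      have := toIcoMod_add_toIcoDiv_zsmul hpi 0 t
      rw [zsmul_eq_mul] at this; exact this.symm⟩
  obtain ⟨b, hb, hub⟩ : ∃ a ∈ Ico 0 (2 * π), ∃ k : ℤ, u = a + k * (2 * π) :=
    ⟨toIcoMod hpi 0 u, by simpa using toIcoMod_mem_Ico hpi 0 u, toIcoDiv hpi 0 u, by
      have := toIcoMod_add_toIcoDiv_zsmul hpi 0 u
      rw [zsmul_eq_mul] at this; exact this.symm⟩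
  obtain ⟨k, rfl⟩ := hta
  obtain ⟨l, rfl⟩ := hub
  have hzk : ∀ (k : ℤ) (s : ℝ), z (s + k * (2 * π)) = z s := fun k s => hP.int_mul k s
  rw [hzk, hzk] at h
  have hab := hi ha hb h
  subst hab
  have hdk : ∀ (k : ℤ) (s : ℝ), deriv z (s + k * (2 * π)) = deriv z s := by
    intro k s
    rw [← deriv_comp_add_const]
    congr 1
    ext1 r
    exact hzk k r
  rw [show a + k * (2 * π) + d = (a + d) + k * (2 * π) by ring,
    show a + l * (2 * π) + d = (a + d) + l * (2 * π) by ring, hdk, hdk]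

set_option maxHeartbeats 2000000 in
/-- (Lemma 2.3) Fix `γ ∈ (0,1]` and `M ≥ M' > 0`. There are `A, B, R > 0`, depending only
on `γ, M, M'`, with `B(3R)^{γ/(1+γ)} ≤ 1/2` and `M(4R)^γ ≤ (M')^{1+γ}`, such that for every
simple closed `C¹` curve `z` with `sup|z| + sup|z'| ≤ M`, Hölder seminorm of `z'` at most
`M`, `|z'| ≥ M'`, passing through the origin with horizontal tangent there (`z(η₀) = 0`,
`z'(η₀) ∥ (1,0)`), and every `ξ` with `z(ξ) ∈ [−R,R]×[−2R,2R]`, there is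
`f : [−R,R] → ℝ` with `‖f‖_{C^{1,γ}} ≤ A`, `f(z₁(ξ)) = z₂(ξ)`,
`|f'(z₁(ξ))| ≤ B|z(ξ)|^{γ/(1+γ)}`, whose graph is a segment of the curve `z` around `z(ξ)`;
consequently `|f(h) − z₂(ξ) − f'(z₁(ξ))(h−z₁(ξ))| ≤ A|h−z₁(ξ)|^{1+γ}` on `[−R,R]`, and if
`|f(h')| > 2R` for some `h' ∈ [−R,R]` then `|f| > R` on all of `[−R,R]`. -/
theorem local_graph_lemma (γ M M' : ℝ)
    (hγ0 : 0 < γ) (hγ1 : γ ≤ 1) (hM' : 0 < M') (hMM : M' ≤ M) :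
    ∃ A B R : ℝ, 0 < A ∧ 0 < B ∧ 0 < R ∧
      B * (3 * R) ^ (γ / (1 + γ)) ≤ 1 / 2 ∧ M * (4 * R) ^ γ ≤ M' ^ (1 + γ) ∧
      ∀ (z : ℝ → R2) (η₀ : ℝ),
        (∀ ξ : ℝ, z (ξ + 2 * π) = z ξ) →
        InjOn z (Ico 0 (2 * π)) →
        ContDiff ℝ 1 z →
        (∀ ξ η : ℝ, ‖z ξ‖ + ‖deriv z η‖ ≤ M) →
        (∀ ξ η : ℝ, ‖deriv z ξ - deriv z η‖ ≤ M * |ξ - η| ^ γ) →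
        (∀ ξ : ℝ, M' ≤ ‖deriv z ξ‖) →
        z η₀ = 0 →
        (deriv z η₀) 1 = 0 →
        ∀ ξ : ℝ, |z ξ 0| ≤ R → |z ξ 1| ≤ 2 * R →
          ∃ f f' : ℝ → ℝ,
            (∀ h ∈ Icc (-R) R, HasDerivWithinAt f (f' h) (Icc (-R) R) h) ∧
            (∀ h ∈ Icc (-R) R, |f h| ≤ A ∧ |f' h| ≤ A) ∧
            (∀ h₁ ∈ Icc (-R) R, ∀ h₂ ∈ Icc (-R) R,
              |f' h₁ - f' h₂| ≤ A * |h₁ - h₂| ^ γ) ∧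
            f (z ξ 0) = z ξ 1 ∧
            |f' (z ξ 0)| ≤ B * ‖z ξ‖ ^ (γ / (1 + γ)) ∧
            (∃ ξ₁ ξ₂ : ℝ, ξ₁ ≤ ξ ∧ ξ ≤ ξ₂ ∧
              (fun h => mk2 h (f h)) '' Icc (-R) R = z '' Icc ξ₁ ξ₂) ∧
            (∀ h ∈ Icc (-R) R,
              |f h - z ξ 1 - f' (z ξ 0) * (h - z ξ 0)| ≤ A * |h - z ξ 0| ^ (1 + γ)) ∧
            ((∃ h' ∈ Icc (-R) R, 2 * R < |f h'|) → ∀ h ∈ Icc (-R) R, R < |f h|) := by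
  have hM : 0 < M := lt_of_lt_of_le hM' hMM
  have h1γ : 0 < 1 + γ := by linarith
  have hθ : 0 < γ / (1 + γ) := by positivity
  set δ : ℝ := (M' / 4 / M) ^ (1 / γ) with hδdef
  have hδ0 : 0 < δ := by positivity
  have hδM : M * δ ^ γ ≤ M' / 4 := by
    rw [hδdef, ← Real.rpow_mul (by positivity), one_div_mul_cancel hγ0.ne', Real.rpow_one]
    exact le_of_eq (by field_simp)
  set R₀ : ℝ := M' * δ / 16 with hR₀
  have hR₀0 : 0 < R₀ := by positivity
  set H : ℝ := 2 * M * (M * (4 / M') ^ γ) / (M' / 4) ^ 2 with hH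
  have hH0 : 0 < H := by positivity
  set A : ℝ := H + M + M * (M' / 4)⁻¹ with hA
  have hA0 : 0 < A := by positivity
  have hAM : M ≤ A := by
    have : 0 < M * (M' / 4)⁻¹ := by positivity
    linarith
  have hAM2 : M * (M' / 4)⁻¹ ≤ A := by linarith
  have hAH : H ≤ A := by
    have : 0 < M * (M' / 4)⁻¹ := by positivity
    linarith
  set C : ℝ := 1 + M + A * (1 + M) ^ 2 + M * (1 + 4 / M' * (1 + M)) ^ γ with hC
  have hC0 : 0 < C := by positivity
  set B : ℝ := C * (M' / 2)⁻¹ with hB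
  have hB0 : 0 < B := by positivity
  obtain ⟨R, hRB, hRM, hRA, hRs, hR1, hRR₀, hR0⟩ :
      ∃ R : ℝ, B * (3 * R) ^ (γ / (1 + γ)) ≤ 1 / 4 ∧ M * (4 * R) ^ γ ≤ M' ^ (1 + γ) ∧
        A * (2 * R) ^ γ ≤ 1 / 4 ∧ (1 + M) * (3 * R) ^ (1 / (1 + γ)) ≤ R₀ ∧
        1 * (3 * R) ^ (1:ℝ) ≤ 1 ∧ 1 * (1 * R) ^ (1:ℝ) ≤ R₀ ∧ 0 < R := by
    apply Filter.Eventually.exists (f := nhdsWithin (0:ℝ) (Ioi 0))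
    filter_upwards [aux_small B _ (1 / 4) hθ (by norm_num) 3,
      aux_small M γ (M' ^ (1 + γ)) hγ0 (by positivity) 4,
      aux_small A γ (1 / 4) hγ0 (by norm_num) 2,
      aux_small (1 + M) (1 / (1 + γ)) R₀ (by positivity) hR₀0 3,
      aux_small 1 1 1 one_pos one_pos 3, aux_small 1 1 R₀ one_pos hR₀0 1,
      self_mem_nhdsWithin] with R h1 h2 h3 h4 h5 h6 h7
    exact ⟨h1, h2, h3, h4, h5, h6, h7⟩
  rw [Real.rpow_one, one_mul] at hR1
  rw [Real.rpow_one, one_mul, one_mul] at hRR₀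
  refine ⟨A, B, R, hA0, hB0, hR0, by linarith, hRM, ?_⟩
  intro z η₀ hper hinj hcd hsup hhol hlow hz0 hz'0 ξ hξ0 hξ1
  have hle : ∀ (v : R2) (i : Fin 2), |v i| ≤ ‖v‖ := fun v i => by
    simpa using PiLp.norm_apply_le v i
  have hsq : ∀ v : R2, ‖v‖ ^ 2 = v 0 ^ 2 + v 1 ^ 2 := fun v => by
    rw [EuclideanSpace.norm_sq_eq, Fin.sum_univ_two]; simp
  have hzd : ∀ t, HasDerivAt z (deriv z t) t := fun t =>
    (hcd.differentiable one_ne_zero t).hasDerivAt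
  have hcomp : ∀ (i : Fin 2) t, HasDerivAt (fun t => z t i) (deriv z t i) t := fun i t =>
    (EuclideanSpace.proj (𝕜 := ℝ) i).hasFDerivAt.comp_hasDerivAt t (hzd t)
  have hholc : ∀ (i : Fin 2) (s t : ℝ), |deriv z s i - deriv z t i| ≤ M * |s - t| ^ γ :=
    fun i s t => (hle (deriv z s - deriv z t) i).trans (hhol s t)
  have hd'M : ∀ (i : Fin 2) t, |deriv z t i| ≤ M := fun i t =>
    (hle _ i).trans (by linarith [hsup t t, norm_nonneg (z t)])
  have hzM : ∀ (i : Fin 2) t, |z t i| ≤ M := fun i t =>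
    (hle _ i).trans (by linarith [hsup t t, norm_nonneg (deriv z t)])
  have hext : ∀ v w : R2, v 0 = w 0 → v 1 = w 1 → v = w := fun v w h0 h1 => by
    ext i; fin_cases i
    · exact h0
    · exact h1
  have hper' : ∀ t u, z t 0 = z u 0 → z t 1 = z u 1 → ∀ d, deriv z (t + d) 1 = deriv z (u + d) 1 :=
    fun t u h0 h1 d => by rw [aux_inj z hper hinj t u (hext _ _ h0 h1) d]
  have hx'0 : M' ≤ |deriv z η₀ 0| := by
    have h1 := hlow η₀
    have h2 := hsq (deriv z η₀)
    rw [hz'0] at h2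
    have : ‖deriv z η₀‖ = |deriv z η₀ 0| := by
      rw [← abs_of_nonneg (norm_nonneg (deriv z η₀)), ← sq_eq_sq_iff_abs_eq_abs, h2]; ring
    linarith
  set q := ‖z ξ‖ with hq
  have hq0 : 0 ≤ q := norm_nonneg _
  have hq3 : q ≤ 3 * R := by
    apply (sq_le_sq₀ hq0 (by positivity)).1
    have i1 := pow_le_pow_left₀ (abs_nonneg _) hξ0 2
    have i2 := pow_le_pow_left₀ (abs_nonneg _) hξ1 2
    rw [hq, hsq, ← sq_abs (z ξ 0), ← sq_abs (z ξ 1)]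
    have i3 := sq_nonneg R
    ring_nf at i1 i2 i3 ⊢
    linarith
  -- slope bound
  have hslope : |deriv z ξ 1| ≤ C * q ^ (γ / (1 + γ)) := by
    rcases hq0.eq_or_lt with h | h
    · have hzξ : z ξ = z η₀ := by rw [hz0]; exact norm_eq_zero.1 h.symm
      have := aux_inj z hper hinj ξ η₀ hzξ 0
      rw [add_zero, add_zero] at this
      rw [this, hz'0, abs_zero]; positivity
    · set s := q ^ (1 / (1 + γ)) with hs
      have hs0 : 0 < s := by positivity
      have e1 : s ^ (1 + γ) = q := by
        rw [hs, ← Real.rpow_mul hq0, one_div_mul_cancel h1γ.ne', Real.rpow_one]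
      have e2 : s ^ γ = q ^ (γ / (1 + γ)) := by
        rw [hs, ← Real.rpow_mul hq0]; congr 1; ring
      have hs3 : s ≤ (3 * R) ^ (1 / (1 + γ)) := by rw [hs]; gcongr
      have hs1 : s ≤ 1 := Real.rpow_le_one hq0 (by linarith) (by positivity)
      rw [← e2]
      exact aux_slope γ M M' δ R₀ A s hγ0 hγ1 hM' hM hR₀0 hδM (by rw [hR₀]; linarith) hAH
        (fun t => z t 0) (fun t => deriv z t 0) (fun t => z t 1) (fun t => deriv z t 1)
        (hcomp 0) (hcomp 1) (hholc 0) (hholc 1) (hd'M 0) (hd'M 1) hper' η₀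
        (by simp [hz0]) (by simp [hz0]) hz'0 hx'0 ξ hs0 hs1
        ((mul_le_mul_of_nonneg_left hs3 (by linarith)).trans hRs)
        (by rw [e1]; exact hle _ _) (by rw [e1]; exact hle _ _)
  have hBq : B * q ^ (γ / (1 + γ)) ≤ 1 / 4 := by
    refine le_trans ?_ hRB
    gcongr
  have hy'4 : |deriv z ξ 1| ≤ M' / 8 := by
    have : C * q ^ (γ / (1 + γ)) = (B * q ^ (γ / (1 + γ))) * (M' / 2) := by
      rw [hB]; field_simp
    rw [this] at hslope
    have := mul_le_mul_of_nonneg_right hBq (by positivity : 0 ≤ M' / 2)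
    linarith
  have hx'ξ : M' / 2 ≤ |deriv z ξ 0| := by
    have h1 := hlow ξ
    have h2 := hsq (deriv z ξ)
    rw [← sq_abs (deriv z ξ 0), ← sq_abs (deriv z ξ 1)] at h2
    by_contra hc
    push Not at hc
    have i1 := pow_le_pow_left₀ (abs_nonneg _) hc.le 2
    have i2 := pow_le_pow_left₀ (abs_nonneg _) hy'4 2
    have i3 := pow_le_pow_left₀ hM'.le h1 2
    have i4 : 0 < M' ^ 2 := by positivity
    rw [h2] at i3
    rw [div_pow] at i1 i2
    linarith
  obtain ⟨t, ht1, ht2, ht3, ht4, ht5, ξ₁, ξ₂, hξ₁, hξ₂, him⟩ :=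
    aux_inv γ M M' δ R hγ0 hM' hM hR0 hδM (by rw [hR₀] at hRR₀; linarith)
      (fun t => z t 0) (fun t => deriv z t 0) (hcomp 0) (hholc 0) ξ hξ0 hx'ξ
  have hHol := aux_holder γ M M' R hγ0 hM' hM (fun t => deriv z t 0) (fun t => deriv z t 1) t
    (hholc 0) (hholc 1) (hd'M 0) (hd'M 1) ht2 ht5
  simp only at ht1 ht3 ht4 ht5 hHol
  have hξm : z ξ 0 ∈ Icc (-R) R := abs_le.1 hξ0
  have hder : ∀ h ∈ Icc (-R) R,
      HasDerivAt (fun h => z (t h) 1) (deriv z (t h) 1 * (deriv z (t h) 0)⁻¹) h :=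
    fun h hm => (hcomp 1 (t h)).comp h (ht4 h hm)
  have hHolA : ∀ h₁ ∈ Icc (-R) R, ∀ h₂ ∈ Icc (-R) R,
      |deriv z (t h₁) 1 * (deriv z (t h₁) 0)⁻¹ - deriv z (t h₂) 1 * (deriv z (t h₂) 0)⁻¹| ≤
        A * |h₁ - h₂| ^ γ := fun a ha b hb =>
    (hHol a ha b hb).trans (by rw [← hH]; gcongr)
  have hfξ : |deriv z ξ 1 * (deriv z ξ 0)⁻¹| ≤ B * q ^ (γ / (1 + γ)) := by
    rw [abs_mul, abs_inv]
    calc |deriv z ξ 1| * |deriv z ξ 0|⁻¹ ≤ (C * q ^ (γ / (1 + γ))) * (M' / 2)⁻¹ := by gcongr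
      _ = _ := by rw [hB]; ring
  have hhalf : ∀ h ∈ Icc (-R) R, |deriv z (t h) 1 * (deriv z (t h) 0)⁻¹| ≤ 1 / 2 := by
    intro h hm
    have h1 := hHolA h hm _ hξm
    rw [ht3] at h1
    have h2 : |h - z ξ 0| ≤ 2 * R := by
      rw [abs_le]; constructor <;> linarith [hm.1, hm.2, hξm.1, hξm.2]
    have h3 : A * |h - z ξ 0| ^ γ ≤ A * (2 * R) ^ γ := by gcongr
    have h4 := abs_sub_abs_le_abs_sub (deriv z (t h) 1 * (deriv z (t h) 0)⁻¹)
      (deriv z ξ 1 * (deriv z ξ 0)⁻¹)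
    linarith
  refine ⟨fun h => z (t h) 1, fun h => deriv z (t h) 1 * (deriv z (t h) 0)⁻¹,
    fun h hm => (hder h hm).hasDerivWithinAt, fun h hm => ⟨(hzM 1 _).trans hAM, ?_⟩, hHolA,
    by simp only [ht3], by simp only [ht3]; exact hfξ, ⟨ξ₁, ξ₂, hξ₁, hξ₂, ?_⟩, ?_, ?_⟩
  · refine le_trans ?_ hAM2
    have h5 := ht5 h hm
    rw [abs_mul, abs_inv]
    have := hd'M 1 (t h)
    gcongr
  · rw [← him, image_image]
    apply image_congr
    intro h hm
    apply hext
    · simp [mk2, ht1 h hm]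
    · simp [mk2]
  · intro h hm
    have hsub : uIcc (z ξ 0) h ⊆ Icc (-R) R :=
      (convex_Icc (-R) R).ordConnected.uIcc_subset hξm hm
    have h1 := aux_taylor γ A hγ0 hA0.le (fun h => z (t h) 1)
      (fun h => deriv z (t h) 1 * (deriv z (t h) 0)⁻¹) (z ξ 0) h
      (fun a ha => hder a (hsub ha)) (fun a ha => hHolA a (hsub ha) _ hξm)
    simp only [ht3] at h1 ⊢
    exact h1
  · rintro ⟨h', hm', hh'⟩ h hm
    have h1 := (convex_Icc (-R) R).norm_image_sub_le_of_norm_hasDerivWithin_le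
      (fun a ha => (hder a ha).hasDerivWithinAt) hhalf hm hm'
    rw [Real.norm_eq_abs, Real.norm_eq_abs] at h1
    have h2 : |h' - h| ≤ 2 * R := by
      rw [abs_le]; constructor <;> linarith [hm.1, hm.2, hm'.1, hm'.2]
    have h3 := abs_sub_abs_le_abs_sub (z (t h') 1) (z (t h) 1)
    simp only at hh' ⊢
    linarith

end
end
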